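/- For any nonnegative integer a, Σ_{|t|=a+1} m(•;t)·n(•;t) = Π_{i=2}^{a+1} C(i, 2), where the sum runs over isomorphism classes of rooted trees t with a+1 vertices and C(i,2) denotes the binomial coefficient. -/

import Mathlib

attribute [local instance] Classical.propDecidable

inductive PlanarTree : Type where
  | node : List PlanarTree → PlanarTree

namespace PlanarTree

/-- Isomorphism of (planar representatives of) rooted trees: the lists of
principal branches match up, pairwise isomorphically, after a permutation. -/
inductive Iso : PlanarTree → PlanarTree → Prop where
  | node {l m l' : List PlanarTree} :
      List.Perm l m → List.Forall₂ Iso m l' → Iso (node l) (node l')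

/-- Number of vertices. -/
def size : PlanarTree → ℕ
  | node l => 1 + (l.attach.map fun c => size c.1).sum
decreasing_by simp only [PlanarTree.node.sizeOf_spec]; exact Nat.lt_of_lt_of_le (List.sizeOf_lt_of_mem c.2) (Nat.le_add_left _ _)

mutual
  /-- All trees obtained by attaching the root of `s` by a new edge to some vertex. -/
  def graftList (s : PlanarTree) : PlanarTree → List PlanarTree
    | node l => node (s :: l) :: (graftAux s l).map node
  def graftAux (s : PlanarTree) : List PlanarTree → List (List PlanarTree)
    | [] => []
    | a :: l => ((graftList s a).map (· :: l)) ++ (graftAux s l).map (a :: ·)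
end

/-- All trees obtained by adding a new edge and terminal vertex at some vertex. -/
def growList (t : PlanarTree) : List PlanarTree := graftList (node []) t

mutual
  /-- All trees obtained by deleting one (non-root) terminal vertex. -/
  def pruneList : PlanarTree → List PlanarTree
    | node l => (pruneAux l).map node
  def pruneAux : List PlanarTree → List (List PlanarTree)
    | [] => []
    | a :: l =>
        (match a with | node [] => [l] | _ => []) ++
        ((pruneList a).map (· :: l)) ++ (pruneAux l).map (a :: ·)
end

mutual
  /-- All pairs (cut-off subtree, remaining tree) obtained by cutting one edge. -/
  def cutPairs : PlanarTree → List (PlanarTree × PlanarTree)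
    | node l => (cutAux l).map fun x => (x.1, node x.2)
  def cutAux : List PlanarTree → List (PlanarTree × List PlanarTree)
    | [] => []
    | a :: l =>
        (a, l) :: (((cutPairs a).map fun x => (x.1, x.2 :: l)) ++
          (cutAux l).map fun x => (x.1, a :: x.2))
end

/-- The order of the symmetry group `SG(t)`: the product over all vertices `v`
of the number of permutations of the branches at `v` exchanging isomorphic branches. -/
noncomputable def sg : PlanarTree → ℕ
  | node l =>
      (l.attach.map fun c => sg c.1).prod *
        Nat.card {σ : Equiv.Perm (Fin l.length) // ∀ i, Iso (l.get (σ i)) (l.get i)}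
decreasing_by simp only [PlanarTree.node.sizeOf_spec]; exact Nat.lt_of_lt_of_le (List.sizeOf_lt_of_mem c.2) (Nat.le_add_left _ _)

/-- Vertices of a planar tree, encoded as paths of child-indices from the root. -/
inductive IsVertex : PlanarTree → List ℕ → Prop where
  | root (t : PlanarTree) : IsVertex t []
  | child {l : List PlanarTree} {i : ℕ} {c : PlanarTree} {p : List ℕ} :
      l[i]? = some c → IsVertex c p → IsVertex (node l) (i :: p)

def Vertex (t : PlanarTree) : Type := {p : List ℕ // IsVertex t p}

/-- `v` lies strictly below `w` in the tree order (i.e. `w` is a proper ancestor of `v`). -/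
def StrictBelow {t : PlanarTree} (v w : Vertex t) : Prop := w.1 <+: v.1 ∧ w.1 ≠ v.1

/-- A labelling of `t`. -/
def Labelling (t : PlanarTree) : Type :=
  {f : Vertex t ≃ Fin t.size // ∀ v w, StrictBelow v w → f w < f v}

/-- Equivalence of labellings: they differ by an automorphism of the rooted tree. -/
def labelEquiv {t : PlanarTree} (f g : Labelling t) : Prop :=
  ∃ φ : Equiv.Perm (Vertex t),
    (∀ v w, StrictBelow (φ v) (φ w) ↔ StrictBelow v w) ∧ ∀ v, f.1 (φ v) = g.1 v

end PlanarTree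

/-- Rooted trees: isomorphism classes of planar rooted trees. -/
instance planarSetoid : Setoid PlanarTree := Relation.EqvGen.setoid PlanarTree.Iso

def RTree : Type := Quotient planarSetoid

namespace RTree

def mk (p : PlanarTree) : RTree := ⟦p⟧

/-- A chosen planar representative. -/
noncomputable def rep (T : RTree) : PlanarTree := Quotient.out T

noncomputable def size (T : RTree) : ℕ := T.rep.size

/-- The order of the symmetry (automorphism) group of `T`. -/
noncomputable def sg (T : RTree) : ℕ := T.rep.sg

/-- The one-vertex tree. -/
def bullet : RTree := mk (PlanarTree.node [])

/-- `Covers T T'` means `T ⊲ T'`: `T` is obtained from `T'` by deleting one terminal vertex. -/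
noncomputable def Covers (T T' : RTree) : Prop :=
  ∃ p ∈ T'.rep.pruneList, mk p = T

/-- `n(T;T')`: the number of vertices of `T` to which a new edge can be added to obtain `T'`. -/
noncomputable def nCov (T T' : RTree) : ℕ :=
  T.rep.growList.countP fun p => decide (mk p = T')

/-- `m(T;T')`: the number of (terminal) edges of `T'` which when removed leave `T`. -/
noncomputable def mCov (T T' : RTree) : ℕ :=
  T'.rep.pruneList.countP fun p => decide (mk p = T)

/-- `n(T₁,T₂;T₃)`: the number of vertices of `T₂` such that attaching the root of `T₁`
there by a new edge yields `T₃`. -/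
noncomputable def nTri (T₁ T₂ T₃ : RTree) : ℕ :=
  (PlanarTree.graftList T₁.rep T₂.rep).countP fun p => decide (mk p = T₃)

/-- `m(T₁,T₂;T₃)`: the number of edges of `T₃` whose removal cuts off a subtree
isomorphic to `T₁` leaving `T₂` (the piece containing the root). -/
noncomputable def mTri (T₁ T₂ T₃ : RTree) : ℕ :=
  T₃.rep.cutPairs.countP fun x => decide (mk x.1 = T₁ ∧ mk x.2 = T₂)

end RTree

section Ops

variable (k : Type*) [Semiring k]

/-- The element `𝔑(T) = Σ_{T ⊲ T'} n(T;T')·T'` of `k{T}`. -/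
noncomputable def growF (T : RTree) : RTree →₀ k :=
  (T.rep.growList.map fun p => Finsupp.single (RTree.mk p) (1 : k)).sum

/-- The element `𝔓(T) = Σ_{T' ⊲ T} m(T';T)·T'` of `k{T}`. -/
noncomputable def pruneF (T : RTree) : RTree →₀ k :=
  (T.rep.pruneList.map fun p => Finsupp.single (RTree.mk p) (1 : k)).sum

/-- The growth operator `𝔑` on `k{T}`. -/
noncomputable def Grow : Module.End k (RTree →₀ k) :=
  Finsupp.linearCombination k (growF k)

/-- The pruning operator `𝔓` on `k{T}`. -/
noncomputable def Prune : Module.End k (RTree →₀ k) :=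
  Finsupp.linearCombination k (pruneF k)

/-- The operator `𝔇` on `k{T}`, `𝔇(t) = |t|·t`. -/
noncomputable def Diag : Module.End k (RTree →₀ k) :=
  Finsupp.linearCombination k fun T => (T.size : k) • Finsupp.single T 1

/-- The inner product on `k{T}` determined by `(t,t') = |SG(t)|·δ_{t,t'}`. -/
noncomputable def innerT (x y : RTree →₀ k) : k :=
  x.sum fun T c => c * y T * (T.sg : k)

/-- Generalized multiplicity `n(T;T')`: coefficient of `T'` in `𝔑^{|T'|-|T|}(T)`. -/
noncomputable def nGen (T T' : RTree) : k :=
  ((Grow k ^ (T'.size - T.size)) (Finsupp.single T 1)) T'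

/-- Generalized multiplicity `m(T;T')`: coefficient of `T` in `𝔓^{|T'|-|T|}(T')`. -/
noncomputable def mGen (T T' : RTree) : k :=
  ((Prune k ^ (T'.size - T.size)) (Finsupp.single T' 1)) T

end Ops

section Kreimer

variable (k : Type*) [CommSemiring k]

/-- Kreimer's Hopf algebra `H_K`, as a commutative algebra: the free polynomial
algebra on rooted trees. -/
abbrev HK := MvPolynomial RTree k

/-- The inclusion `k{T} → H_K` of the linear span of the variables. -/
noncomputable def toHK : (RTree →₀ k) →ₗ[k] HK k :=
  Finsupp.linearCombination k fun T => MvPolynomial.X T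

/-- The growth derivation `N` on `H_K`, with `N(t) = 𝔑(t)` for rooted trees `t`. -/
noncomputable def ND : Derivation k (HK k) (HK k) :=
  MvPolynomial.mkDerivation k fun T => toHK k (growF k T)

/-- The pruning derivation `P` on `H_K`, with `P(t) = 𝔓(t)` for `|t| ≥ 2`, `P(•) = 1`. -/
noncomputable def PD : Derivation k (HK k) (HK k) :=
  MvPolynomial.mkDerivation k fun T =>
    if T = RTree.bullet then 1 else toHK k (pruneF k T)

/-- The grading derivation `D` on `H_K`, multiplying each homogeneous element of
degree `n` by `n`; it is the derivation with `D(t) = |t|·t` for rooted trees `t`. -/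
noncomputable def DD : Derivation k (HK k) (HK k) :=
  MvPolynomial.mkDerivation k fun T => (T.size : k) • MvPolynomial.X T

/-- The map `B₊ : H_K → k{T}` sending a forest to the tree obtained by attaching
all its roots to a new root vertex. -/
noncomputable def forestTree (d : RTree →₀ ℕ) : RTree :=
  RTree.mk (PlanarTree.node
    (d.support.toList.flatMap fun T => List.replicate (d T) T.rep))

noncomputable def Bplus (p : HK k) : RTree →₀ k :=
  ∑ d ∈ p.support, Finsupp.single (forestTree d) (MvPolynomial.coeff d p)

/-- The inner product on `H_K`. -/
noncomputable def innerHK (u v : HK k) : k := innerT k (Bplus k u) (Bplus k v)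

/-- The degree-`n` homogeneous component of `H_K`. -/
noncomputable abbrev HKcomp (n : ℕ) : Submodule k (HK k) :=
  MvPolynomial.weightedHomogeneousSubmodule k (fun T : RTree => T.size) n

/-- `T_i`: the number of rooted trees with `i+1` vertices. -/
noncomputable def Tcard (i : ℕ) : ℕ := Nat.card {T : RTree // T.size = i + 1}

end Kreimer

namespace PlanarTree

theorem size_node (l : List PlanarTree) : size (node l) = 1 + (l.map size).sum := by
  rw [size, List.attach_map_val]

theorem pruneAux_cons (a : PlanarTree) (l : List PlanarTree) :
    pruneAux (a :: l) = (if a = node [] then [l] else []) ++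
      ((pruneList a).map (· :: l)) ++ (pruneAux l).map (a :: ·) := by
  rcases a with ⟨_ | ⟨b, m⟩⟩
  · simp [pruneAux]
  · rw [pruneAux, if_neg (by simp)]
    simp

/-- Simultaneous induction on trees and forests. -/
theorem induction_forest {P : PlanarTree → Prop} {Q : List PlanarTree → Prop}
    (node : ∀ l, Q l → P (node l)) (nil : Q []) (cons : ∀ a l, P a → Q l → Q (a :: l)) :
    (∀ t, P t) ∧ ∀ l, Q l :=
  have h : ∀ t, P t := fun t => PlanarTree.rec (motive_1 := P) (motive_2 := Q) node nil cons t
  ⟨h, fun l => by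
    induction l with
    | nil => exact nil
    | cons a l ih => exact cons a l (h a) ih⟩

theorem Iso.refl (t : PlanarTree) : Iso t t :=
  (induction_forest (P := fun t => Iso t t) (Q := fun l => List.Forall₂ Iso l l)
    (fun l h => .node (List.Perm.refl l) h) .nil (fun _ _ h h' => .cons h h')).1 t

theorem ne_node_nil_of_mem_growList {s q : PlanarTree} (h : q ∈ growList s) : q ≠ node [] := by
  obtain ⟨l⟩ := s
  rw [growList, graftList, List.mem_cons, List.mem_map] at h
  rcases h with rfl | ⟨l', hl', rfl⟩
  · simp
  · rintro ⟨⟩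
    cases l with
    | nil => simp [graftAux] at hl'
    | cons a l => simp [graftAux] at hl'

theorem size_grow :
    (∀ t, ∀ q ∈ growList t, size q = size t + 1) ∧
    ∀ l, ∀ m ∈ graftAux (node []) l, (m.map size).sum = (l.map size).sum + 1 := by
  refine induction_forest ?_ ?_ ?_
  · intro l ih q hq
    rw [growList, graftList, List.mem_cons, List.mem_map] at hq
    rcases hq with rfl | ⟨l', hl', rfl⟩
    · simp [size_node]; omega
    · rw [size_node, size_node, ih l' hl']; omega
  · simp [graftAux]
  · intro a l ha hl m hm
    rw [graftAux, List.mem_append, List.mem_map, List.mem_map] at hm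
    rcases hm with ⟨b, hb, rfl⟩ | ⟨m, hm, rfl⟩
    · simp [ha b hb]; omega
    · simp [hl m hm]; omega

theorem sum_map_comm {α β M : Type*} [AddCommMonoid M] (l : List α) (m : List β)
    (f : α → β → M) :
    (l.map fun a => (m.map fun b => f a b).sum).sum =
      (m.map fun b => (l.map fun a => f a b).sum).sum := by
  simpa using Multiset.sum_map_sum_map (l : Multiset α) (m : Multiset β) (f := f)

theorem sum_graftAux_cons {M : Type*} [AddCommMonoid M] (F : List PlanarTree → M)
    (a : PlanarTree) (l : List PlanarTree) :
    ((graftAux (node []) (a :: l)).map F).sum =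
      ((growList a).map fun b => F (b :: l)).sum +
        ((graftAux (node []) l).map fun m => F (a :: m)).sum := by
  simp [graftAux, growList, Function.comp_def]

theorem sum_pruneAux_cons {M : Type*} [AddCommMonoid M] (F : List PlanarTree → M)
    (a : PlanarTree) (l : List PlanarTree) :
    ((pruneAux (a :: l)).map F).sum =
      (if a = node [] then F l else 0) + ((pruneList a).map fun b => F (b :: l)).sum +
        ((pruneAux l).map fun m => F (a :: m)).sum := by
  by_cases h : a = node [] <;> simp [pruneAux_cons, Function.comp_def, h, add_assoc]

theorem sum_growList_node {M : Type*} [AddCommMonoid M] (F : PlanarTree → M)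
    (l : List PlanarTree) :
    ((growList (node l)).map F).sum =
      F (node (node [] :: l)) + ((graftAux (node []) l).map fun m => F (node m)).sum := by
  simp [growList, graftList, Function.comp_def]

theorem sum_pruneList_node {M : Type*} [AddCommMonoid M] (F : PlanarTree → M)
    (l : List PlanarTree) :
    ((pruneList (node l)).map F).sum = ((pruneAux l).map fun m => F (node m)).sum := by
  simp [pruneList, Function.comp_def]

/-- The commutation relation between growing and pruning, summed against a test function. -/
theorem sum_prune_grow (M : Type*) [AddCommMonoid M] :
    (∀ t, ∀ F : PlanarTree → M,
      ((growList t).map fun q => ((pruneList q).map F).sum).sum =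
        ((pruneList t).map fun q => ((growList q).map F).sum).sum + size t • F t) ∧
    ∀ l, ∀ F : List PlanarTree → M,
      ((graftAux (node []) l).map fun m => ((pruneAux m).map F).sum).sum =
        ((pruneAux l).map fun m => ((graftAux (node []) m).map F).sum).sum +
          (l.map size).sum • F l := by
  refine induction_forest ?_ ?_ ?_
  · intro l ih F
    simp only [sum_growList_node, sum_pruneList_node, sum_pruneAux_cons, ih, size_node,
      List.sum_map_add, add_smul, one_smul, if_true]
    simp [pruneAux]
    abel
  · simp [graftAux, pruneAux]
  · intro a l ha hl F
    have h0 : ((growList a).map fun b => if b = node [] then F l else 0).sum = 0 := by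
      refine List.sum_eq_zero fun x hx => ?_
      obtain ⟨b, hb, rfl⟩ := List.mem_map.1 hx
      exact if_neg (ne_node_nil_of_mem_growList hb)
    have hif : ((graftAux (node []) l).map fun m => if a = node [] then F m else 0).sum =
        if a = node [] then ((graftAux (node []) l).map F).sum else 0 := by
      split_ifs <;> simp
    simp only [sum_graftAux_cons, sum_pruneAux_cons, List.sum_map_add, h0, hif, zero_add,
      ha fun b => F (b :: l), hl fun m => F (a :: m), List.map_cons, List.sum_cons, add_smul]
    rw [sum_map_comm (growList a), sum_map_comm (graftAux (node []) l)]
    abel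

end PlanarTree

namespace RTree

open PlanarTree

theorem mk_rep (T : RTree) : mk T.rep = T := Quotient.out_eq T

theorem mk_eq_of_iso {p q : PlanarTree} (h : Iso p q) : mk p = mk q :=
  Quotient.sound (Relation.EqvGen.rel _ _ h)

/-- An `Iso`-invariant function is constant on isomorphism classes. -/
theorem congr_of_mk_eq {α : Type*} (f : PlanarTree → α) (hf : ∀ p q, Iso p q → f p = f q)
    {p q : PlanarTree} (h : mk p = mk q) : f p = f q := by
  have h' : Relation.EqvGen Iso p q := Quotient.exact h
  clear h
  induction h' with
  | rel p q h => exact hf p q h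
  | refl p => rfl
  | symm p q h ih => exact ih.symm
  | trans p q r h h' ih ih' => exact ih.trans ih'

theorem mk_node_perm {l l' : List PlanarTree} (h : l.Perm l') : mk (node l) = mk (node l') :=
  mk_eq_of_iso (.node h (List.forall₂_same.2 fun t _ => Iso.refl t))

theorem mk_node_cons_congr {a b : PlanarTree} (h : mk a = mk b) (l : List PlanarTree) :
    mk (node (a :: l)) = mk (node (b :: l)) :=
  congr_of_mk_eq (fun t => mk (node (t :: l))) (fun _ _ h => mk_eq_of_iso
    (.node (List.Perm.refl _) (.cons h (List.forall₂_same.2 fun t _ => Iso.refl t)))) h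

theorem mk_node_map_rep (l m : List PlanarTree) :
    mk (node (l ++ m)) = mk (node ((l.map mk).map rep ++ m)) := by
  induction l generalizing m with
  | nil => rfl
  | cons a l ih =>
    calc mk (node (a :: (l ++ m))) = mk (node ((mk a).rep :: (l ++ m))) :=
          mk_node_cons_congr (mk_rep _).symm _
      _ = mk (node (l ++ (mk a).rep :: m)) := mk_node_perm List.perm_middle.symm
      _ = mk (node ((l.map mk).map rep ++ (mk a).rep :: m)) := ih _
      _ = _ := mk_node_perm List.perm_middle

/-- The tree whose principal branches form the given multiset. -/
noncomputable def ofBranches (s : Multiset RTree) : RTree := mk (node (s.toList.map rep))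

/-- The multiset of isomorphism classes of a list of planar trees. -/
def classes (l : List PlanarTree) : Multiset RTree := (l.map mk : List RTree)

theorem classes_cons (a : PlanarTree) (l : List PlanarTree) :
    classes (a :: l) = mk a ::ₘ classes l := rfl

theorem ofBranches_classes (l : List PlanarTree) : ofBranches (classes l) = mk (node l) := by
  have h : (classes l).toList.Perm (l.map mk) := Multiset.coe_eq_coe.1 (Multiset.coe_toList _)
  have h' := mk_node_map_rep l []
  rw [List.append_nil, List.append_nil] at h'
  rw [h', ofBranches]
  exact mk_node_perm (h.map rep)

/-- The classes of the trees in `growList t`. -/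
def growClasses (t : PlanarTree) : Multiset RTree := classes (growList t)

/-- The classes of the trees in `pruneList t`. -/
def pruneClasses (t : PlanarTree) : Multiset RTree := classes (pruneList t)

def graftAuxClasses (l : List PlanarTree) : Multiset (Multiset RTree) :=
  ((graftAux (node []) l).map classes : List _)

def pruneAuxClasses (l : List PlanarTree) : Multiset (Multiset RTree) :=
  ((pruneAux l).map classes : List _)

theorem growClasses_node (l : List PlanarTree) :
    growClasses (node l) =
      ofBranches (bullet ::ₘ classes l) ::ₘ (graftAuxClasses l).map ofBranches := by
  rw [bullet, ← classes_cons, ofBranches_classes]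
  simp [growClasses, classes, growList, graftList, graftAuxClasses, Function.comp_def,
    ← ofBranches_classes]

theorem pruneClasses_node (l : List PlanarTree) :
    pruneClasses (node l) = (pruneAuxClasses l).map ofBranches := by
  simp [pruneClasses, classes, pruneList, pruneAuxClasses, Function.comp_def,
    ← ofBranches_classes]

theorem graftAuxClasses_cons (a : PlanarTree) (l : List PlanarTree) :
    graftAuxClasses (a :: l) = (growClasses a).map (· ::ₘ classes l) +
      (graftAuxClasses l).map (mk a ::ₘ ·) := by
  simp [graftAuxClasses, graftAux, growClasses, growList, classes, Function.comp_def]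

theorem pruneAuxClasses_cons (a : PlanarTree) (l : List PlanarTree) :
    pruneAuxClasses (a :: l) = (if a = node [] then {classes l} else 0) +
      (pruneClasses a).map (· ::ₘ classes l) + (pruneAuxClasses l).map (mk a ::ₘ ·) := by
  by_cases h : a = node [] <;>
    simp [pruneAuxClasses, pruneAux_cons, pruneClasses, classes, Function.comp_def, h]

theorem graftAuxClasses_perm {l m : List PlanarTree} (h : l.Perm m) :
    classes l = classes m ∧ graftAuxClasses l = graftAuxClasses m ∧
      pruneAuxClasses l = pruneAuxClasses m := by
  induction h with
  | nil => simp
  | cons a h ih =>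
    simp only [classes_cons, graftAuxClasses_cons, pruneAuxClasses_cons, ih, and_self]
  | swap a b l =>
    have hs (d : RTree) (s u : Multiset RTree) :
        u.map (fun x => d ::ₘ x ::ₘ s) = u.map fun x => x ::ₘ d ::ₘ s :=
      Multiset.map_congr rfl fun x _ => Multiset.cons_swap _ _ _
    have hab (u : Multiset (Multiset RTree)) :
        u.map (fun x => mk a ::ₘ mk b ::ₘ x) = u.map fun x => mk b ::ₘ mk a ::ₘ x :=
      Multiset.map_congr rfl fun x _ => Multiset.cons_swap _ _ _
    refine ⟨by simp only [classes_cons, Multiset.cons_swap (mk a)], ?_, ?_⟩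
    · simp only [graftAuxClasses_cons, classes_cons, Multiset.map_add, Multiset.map_map,
        Function.comp_def, hs, hab]
      abel
    · have hif : ∀ (c : Prop) (d : PlanarTree),
          Multiset.map (mk d ::ₘ ·) (if c then {classes l} else 0) =
            if c then {mk d ::ₘ classes l} else 0 := by
        intro c d; split_ifs <;> simp
      simp only [pruneAuxClasses_cons, classes_cons, Multiset.map_add, Multiset.map_map,
        Function.comp_def, hs, hab, hif]
      abel
  | trans _ _ ih ih' =>
    exact ⟨ih.1.trans ih'.1, ih.2.1.trans ih'.2.1, ih.2.2.trans ih'.2.2⟩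

theorem classes_congr_of_iso {p q : PlanarTree} (h : Iso p q) :
    (p = node [] ↔ q = node []) ∧ p.size = q.size ∧ growClasses p = growClasses q ∧
      pruneClasses p = pruneClasses q := by
  refine Iso.rec
    (motive_1 := fun p q _ => (p = node [] ↔ q = node []) ∧ p.size = q.size ∧
      growClasses p = growClasses q ∧ pruneClasses p = pruneClasses q)
    (motive_2 := fun l m _ => classes l = classes m ∧ (l.map PlanarTree.size).sum = (m.map PlanarTree.size).sum ∧
      graftAuxClasses l = graftAuxClasses m ∧ pruneAuxClasses l = pruneAuxClasses m)
    ?_ ?_ ?_ h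
  · intro l m l' hp hf ⟨h1, h2, h3, h4⟩
    obtain ⟨h1', h3', h4'⟩ := graftAuxClasses_perm hp
    refine ⟨?_, ?_, ?_, ?_⟩
    · have := hp.length_eq.trans hf.length_eq
      simp only [node.injEq, ← List.length_eq_zero_iff, this]
    · rw [size_node, size_node, ← h2, (hp.map PlanarTree.size).sum_eq]
    · rw [growClasses_node, growClasses_node, h1', h1, h3', h3]
    · rw [pruneClasses_node, pruneClasses_node, h4', h4]
  · simp
  · intro a b l m hab hlm ⟨h1, h2, h3, h4⟩ ⟨h1', h2', h3', h4'⟩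
    simp only [classes_cons, List.map_cons, List.sum_cons, graftAuxClasses_cons,
      pruneAuxClasses_cons, mk_eq_of_iso hab, h1, h2, h3, h4, h1', h2', h3', h4', and_self]

theorem size_mk (p : PlanarTree) : (mk p).size = p.size :=
  congr_of_mk_eq PlanarTree.size (fun _ _ h => (classes_congr_of_iso h).2.1) (mk_rep _)

theorem size_bullet : bullet.size = 1 := by simp [bullet, size_mk, size_node]

end RTree

section Ops

open RTree PlanarTree

variable (k : Type*) [Semiring k]

theorem growF_mk (p : PlanarTree) :
    growF k (RTree.mk p) =
      (p.growList.map fun q => Finsupp.single (RTree.mk q) (1 : k)).sum := by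
  have h := congr_of_mk_eq growClasses (fun _ _ h => (classes_congr_of_iso h).2.2.1)
    (mk_rep (RTree.mk p))
  simpa [growF, growClasses, classes, Function.comp_def] using
    congrArg (fun s => (s.map fun T => Finsupp.single T (1 : k)).sum) h

theorem pruneF_mk (p : PlanarTree) :
    pruneF k (RTree.mk p) =
      (p.pruneList.map fun q => Finsupp.single (RTree.mk q) (1 : k)).sum := by
  have h := congr_of_mk_eq pruneClasses (fun _ _ h => (classes_congr_of_iso h).2.2.2)
    (mk_rep (RTree.mk p))
  simpa [pruneF, pruneClasses, classes, Function.comp_def] using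
    congrArg (fun s => (s.map fun T => Finsupp.single T (1 : k)).sum) h

end Ops

section Commutator

open RTree PlanarTree

variable (k : Type*) [CommSemiring k]

theorem Grow_single (T : RTree) : Grow k (Finsupp.single T 1) = growF k T := by simp [Grow]

theorem Prune_single (T : RTree) : Prune k (Finsupp.single T 1) = pruneF k T := by simp [Prune]

theorem Diag_single (T : RTree) :
    Diag k (Finsupp.single T 1) = (T.size : k) • Finsupp.single T 1 := by simp [Diag]

theorem Prune_Grow (x : RTree →₀ k) :
    Prune k (Grow k x) = Grow k (Prune k x) + Diag k x := by
  suffices h : Prune k ∘ₗ Grow k = Grow k ∘ₗ Prune k + Diag k from LinearMap.congr_fun h x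
  refine Finsupp.lhom_ext' fun T => LinearMap.ext_ring ?_
  simp only [LinearMap.comp_apply, LinearMap.add_apply, Finsupp.lsingle_apply, Grow_single,
    Prune_single, Diag_single]
  rw [growF, pruneF, map_list_sum, map_list_sum, List.map_map, List.map_map]
  simp only [Function.comp_def, Grow_single, Prune_single, growF_mk, pruneF_mk]
  rw [(sum_prune_grow (RTree →₀ k)).1 T.rep, mk_rep, Nat.cast_smul_eq_nsmul, RTree.size]

theorem Diag_Grow (x : RTree →₀ k) :
    Diag k (Grow k x) = Grow k (Diag k x) + Grow k x := by
  suffices h : Diag k ∘ₗ Grow k = Grow k ∘ₗ Diag k + Grow k from LinearMap.congr_fun h x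
  refine Finsupp.lhom_ext' fun T => LinearMap.ext_ring ?_
  simp only [LinearMap.comp_apply, LinearMap.add_apply, Finsupp.lsingle_apply, Grow_single,
    Diag_single, map_smul]
  have h : ((T.size : k) • growF k T + growF k T) = ((T.size + 1 : ℕ) : k) • growF k T := by
    rw [Nat.cast_succ, add_smul, one_smul]
  rw [h, growF, map_list_sum, List.smul_sum, List.map_map, List.map_map, RTree.size]
  congr 1
  refine List.map_congr_left fun q hq => ?_
  simp only [Function.comp_apply, Diag_single, size_mk, size_grow.1 _ q hq]

theorem Diag_apply (x : RTree →₀ k) (T : RTree) : Diag k x T = (T.size : k) * x T := by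
  induction x using Finsupp.induction_linear with
  | zero => simp
  | add x y hx hy => simp [hx, hy, mul_add]
  | single S c =>
    by_cases h : S = T
    · subst h; simp [Diag, mul_comm]
    · simp [Diag, Finsupp.single_eq_of_ne' h]

/-- `𝔑^n(•)`. -/
noncomputable def growBullet (n : ℕ) : RTree →₀ k := (Grow k ^ n) (Finsupp.single bullet 1)

theorem growBullet_succ (n : ℕ) : growBullet k (n + 1) = Grow k (growBullet k n) := by
  rw [growBullet, pow_succ', Module.End.mul_apply, growBullet]

theorem Diag_growBullet (n : ℕ) :
    Diag k (growBullet k n) = ((n + 1 : ℕ) : k) • growBullet k n := by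
  induction n with
  | zero => simp [growBullet, Diag_single, size_bullet]
  | succ n ih =>
    rw [growBullet_succ, Diag_Grow, ih, map_smul, Nat.cast_succ (n + 1), add_smul, one_smul]

theorem Prune_bullet : Prune k (Finsupp.single bullet 1) = 0 := by
  rw [Prune_single, bullet, pruneF_mk]
  simp [pruneList, pruneAux]

theorem Grow_Prune_growBullet (n : ℕ) :
    Grow k (Prune k (growBullet k n)) = (((n + 1).choose 2 : ℕ) : k) • growBullet k n ∧
    Prune k (growBullet k (n + 1)) = (((n + 2).choose 2 : ℕ) : k) • growBullet k n := by
  have step : ∀ n,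
      Grow k (Prune k (growBullet k n)) = (((n + 1).choose 2 : ℕ) : k) • growBullet k n →
      Prune k (growBullet k (n + 1)) = (((n + 2).choose 2 : ℕ) : k) • growBullet k n := by
    intro n h
    rw [growBullet_succ, Prune_Grow, h, Diag_growBullet, ← add_smul, ← Nat.cast_add,
      Nat.choose_succ_succ' (n + 1) 1, Nat.choose_one_right, add_comm]
  induction n with
  | zero =>
    have h : Grow k (Prune k (growBullet k 0)) =
        (((0 + 1).choose 2 : ℕ) : k) • growBullet k 0 := by
      simp [growBullet, Prune_bullet]
    exact ⟨h, step 0 h⟩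
  | succ n ih =>
    have h : Grow k (Prune k (growBullet k (n + 1))) =
        (((n + 1 + 1).choose 2 : ℕ) : k) • growBullet k (n + 1) := by
      rw [ih.2, map_smul, growBullet_succ]
    exact ⟨h, step _ h⟩

theorem Prune_pow_growBullet (n : ℕ) :
    (Prune k ^ n) (growBullet k n) =
      (∏ i ∈ Finset.Icc 2 (n + 1), ((i.choose 2 : ℕ) : k)) • Finsupp.single bullet 1 := by
  induction n with
  | zero => simp [growBullet]
  | succ n ih =>
    rw [pow_succ, Module.End.mul_apply, (Grow_Prune_growBullet k n).2, map_smul, ih, smul_smul,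
      Finset.prod_Icc_succ_top (show 2 ≤ n + 1 + 1 by omega), mul_comm]

end Commutator

/-- `Σ_{|t|=a+1} m(•;t)·n(•;t) = Π_{i=2}^{a+1} C(i,2)`. -/
theorem stmt11 (k : Type*) [Field k] [CharZero k] (a : ℕ) :
    (∑ᶠ t ∈ {t : RTree | RTree.size t = a + 1}, mGen k RTree.bullet t * nGen k RTree.bullet t)
      = ∏ i ∈ Finset.Icc 2 (a + 1), ((i.choose 2 : ℕ) : k) := by
  have hsize : ∀ t ∈ (growBullet k a).support, t.size = a + 1 := by
    intro t ht
    have h := DFunLike.congr_fun (Diag_growBullet k a) t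
    rw [Diag_apply, Finsupp.smul_apply, smul_eq_mul] at h
    exact Nat.cast_injective (mul_right_cancel₀ (Finsupp.mem_support_iff.1 ht) h)
  have hterm : ∀ t : RTree, t.size = a + 1 → mGen k RTree.bullet t * nGen k RTree.bullet t =
      (Prune k ^ a) (Finsupp.single t 1) RTree.bullet * growBullet k a t := by
    intro t ht
    rw [mGen, nGen, ht, RTree.size_bullet, Nat.add_sub_cancel, growBullet]
  have hsum : (∑ᶠ t ∈ {t : RTree | RTree.size t = a + 1},
      mGen k RTree.bullet t * nGen k RTree.bullet t) = ∑ t ∈ (growBullet k a).support,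
        (Prune k ^ a) (Finsupp.single t 1) RTree.bullet * growBullet k a t := by
    rw [← finsum_mem_finset_eq_sum]
    refine (finsum_mem_congr rfl hterm).trans ?_
    refine finsum_mem_inter_support_eq' _ _ _ fun t ht => ⟨fun _ => ?_, hsize t⟩
    exact Finsupp.mem_support_iff.2 (right_ne_zero_of_mul ht)
  have hx : (Prune k ^ a) (growBullet k a) = ∑ t ∈ (growBullet k a).support,
      growBullet k a t • (Prune k ^ a) (Finsupp.single t 1) := by
    conv_lhs => rw [← Finsupp.sum_single (growBullet k a), Finsupp.sum, map_sum]
    refine Finset.sum_congr rfl fun t _ => ?_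
    rw [← map_smul, Finsupp.smul_single_one]
  have h := DFunLike.congr_fun (hx.symm.trans (Prune_pow_growBullet k a)) RTree.bullet
  rw [Finsupp.finsetSum_apply, Finsupp.smul_apply, Finsupp.single_eq_same, smul_eq_mul,
    mul_one] at h
  rw [hsum, ← h]
  exact Finset.sum_congr rfl fun t _ => by rw [Finsupp.smul_apply, smul_eq_mul, mul_comm]
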